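/- arXiv:1907.09039 — 4 statements merged into one kernel-verified Lean document; each statement's English description precedes it below -/
import Mathlib

section
/- Let k > 0, c > 0, ν > 0 and let δ > 0. If Q and Q̃ are two continuous functions from [0,δ] to [0,∞) with Q(0) = Q̃(0) = 0, Q(s) > 0 and Q̃(s) > 0 for s ∈ (0,δ], both differentiable on (0,δ] and satisfying the singular ODE dQ/ds = ν + (k/Q)(1 − cs) there, then Q = Q̃ on [0,δ]. -/
open Set Filter

/-- **Uniqueness for the singular threshold ODE** (Appendix B, Lemma B.1).
If `Q` and `Q̃` are continuous on `[0,δ]`, vanish at `0`, are positive on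
`(0,δ]`, differentiable on `(0,δ]` and both satisfy the singular ODE
`dQ/ds = ν + (k/Q)(1 - cs)` there, then `Q = Q̃` on `[0,δ]`. -/
theorem singular_threshold_ode_unique (k c ν δ : ℝ)
    (hk : 0 < k) (hc : 0 < c) (hν : 0 < ν) (hδ : 0 < δ)
    (Q Qt : ℝ → ℝ)
    (hQcont : ContinuousOn Q (Icc 0 δ)) (hQtcont : ContinuousOn Qt (Icc 0 δ))
    (hQ0 : Q 0 = 0) (hQt0 : Qt 0 = 0)
    (hQpos : ∀ s ∈ Ioc (0 : ℝ) δ, 0 < Q s)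
    (hQtpos : ∀ s ∈ Ioc (0 : ℝ) δ, 0 < Qt s)
    (hQode : ∀ s ∈ Ioc (0 : ℝ) δ,
      HasDerivWithinAt Q (ν + k / Q s * (1 - c * s)) (Icc 0 δ) s)
    (hQtode : ∀ s ∈ Ioc (0 : ℝ) δ,
      HasDerivWithinAt Qt (ν + k / Qt s * (1 - c * s)) (Icc 0 δ) s) :
    ∀ s ∈ Icc (0 : ℝ) δ, Q s = Qt s := by
  obtain ⟨M, hM0, hM⟩ : ∃ M : ℝ, 0 ≤ M ∧
      ∀ s ∈ Ioc (0 : ℝ) δ, k * (c * s - 1) / (Q s * Qt s) ≤ M := by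
    have hm : 0 < min (1 / c) δ := lt_min (by positivity) hδ
    have hsub : Icc (min (1 / c) δ) δ ⊆ Icc 0 δ := Icc_subset_Icc_left hm.le
    have hcont : ContinuousOn (fun s => k * (c * s - 1) / (Q s * Qt s))
        (Icc (min (1 / c) δ) δ) := by
      refine ContinuousOn.div (by fun_prop) ((hQcont.mono hsub).mul (hQtcont.mono hsub)) ?_
      intro s hs
      have hs' : s ∈ Ioc (0 : ℝ) δ := ⟨hm.trans_le hs.1, hs.2⟩
      exact (mul_pos (hQpos s hs') (hQtpos s hs')).ne'
    obtain ⟨M, hM⟩ := isCompact_Icc.bddAbove_image hcont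
    refine ⟨max M 0, le_max_right _ _, fun s hs => ?_⟩
    rcases le_total (1 / c) s with h | h
    · exact (hM (mem_image_of_mem _ ⟨(min_le_left _ _).trans h, hs.2⟩)).trans (le_max_left _ _)
    · refine le_trans ?_ (le_max_right _ _)
      refine div_nonpos_of_nonpos_of_nonneg ?_ (mul_pos (hQpos s hs) (hQtpos s hs)).le
      rw [le_div_iff₀ hc] at h
      exact mul_nonpos_of_nonneg_of_nonpos hk.le (by linarith)
  have hanti : AntitoneOn (fun s => (Q s - Qt s) ^ 2 * Real.exp (-(2 * M) * s)) (Icc 0 δ) := by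
    refine antitoneOn_of_hasDerivWithinAt_nonpos (convex_Icc 0 δ)
      (f' := fun s => (2 * (Q s - Qt s) * ((ν + k / Q s * (1 - c * s)) -
          (ν + k / Qt s * (1 - c * s)))) * Real.exp (-(2 * M) * s) +
        (Q s - Qt s) ^ 2 * (Real.exp (-(2 * M) * s) * (-(2 * M)))) ?_ ?_ ?_
    · exact ((hQcont.sub hQtcont).pow 2).mul (by fun_prop)
    · intro s hs
      have hs' : s ∈ Ioc (0 : ℝ) δ := by
        rw [interior_Icc] at hs
        exact Ioo_subset_Ioc_self hs
      have hexp : HasDerivAt (fun s : ℝ => Real.exp (-(2 * M) * s))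
          (Real.exp (-(2 * M) * s) * (-(2 * M))) s := by
        simpa using ((hasDerivAt_id s).const_mul (-(2 * M))).exp
      have h := ((((hQode s hs').sub (hQtode s hs')).pow 2).mul
        hexp.hasDerivWithinAt).mono interior_subset
      refine h.congr_deriv ?_
      simp
    · intro s hs
      have hs' : s ∈ Ioc (0 : ℝ) δ := by
        rw [interior_Icc] at hs
        exact Ioo_subset_Ioc_self hs
      have hq := (hQpos s hs').ne'
      have hqt := (hQtpos s hs').ne'
      have heq : (2 * (Q s - Qt s) * ((ν + k / Q s * (1 - c * s)) -
          (ν + k / Qt s * (1 - c * s)))) * Real.exp (-(2 * M) * s) +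
          (Q s - Qt s) ^ 2 * (Real.exp (-(2 * M) * s) * (-(2 * M))) =
          2 * (Q s - Qt s) ^ 2 * Real.exp (-(2 * M) * s) *
            (k * (c * s - 1) / (Q s * Qt s) - M) := by
        field_simp
        ring
      rw [heq]
      exact mul_nonpos_of_nonneg_of_nonpos (by positivity) (sub_nonpos.2 (hM s hs'))
  intro s hs
  have h := hanti (left_mem_Icc.2 hδ.le) hs hs.1
  simp only [hQ0, hQt0, sub_self, ne_eq, OfNat.ofNat_ne_zero, not_false_eq_true, zero_pow,
    zero_mul] at h
  have hsq : (Q s - Qt s) ^ 2 ≤ 0 := nonpos_of_mul_nonpos_left h (Real.exp_pos _)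
  exact sub_eq_zero.1 (pow_eq_zero_iff two_ne_zero |>.1 (le_antisymm hsq (sq_nonneg _)))
end

section
/- Let k, c, ν ∈ ℝ and T > 0, and let ρ, d : [0,T) → ℝ be C¹ functions with ρ(t) > 0 for all t, satisfying ρ' = −ρ d and d' = −d² − ν d + k(ρ − c). Then the functions r := −d/ρ and s := 1/ρ are C¹ on [0,T) and satisfy the linear system r' = −ν r − k(1 − c s) and s' = −r; consequently s is twice differentiable and satisfies s'' + ν s' + k c s = k, with s(0) = 1/ρ(0) and s'(0) = d(0)/ρ(0). -/
open Set Filter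

/-- **Linearizing transformation of the characteristic system** (Section 2).
If `ρ, d : [0,T) → ℝ` are `C¹` with `ρ > 0` and satisfy `ρ' = -ρd`,
`d' = -d² - νd + k(ρ - c)`, then `r := -d/ρ` and `s := 1/ρ` are `C¹` on `[0,T)`
and satisfy the linear system `r' = -νr - k(1 - cs)`, `s' = -r`; consequently
`s` is twice differentiable with `s'' + νs' + kcs = k`, `s(0) = 1/ρ(0)` and
`s'(0) = d(0)/ρ(0)`. -/
theorem characteristic_linearization (k c ν T : ℝ) (hT : 0 < T)
    (ρ d : ℝ → ℝ)
    (hρC1 : ContDiffOn ℝ 1 ρ (Ico 0 T)) (hdC1 : ContDiffOn ℝ 1 d (Ico 0 T))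
    (hρpos : ∀ t ∈ Ico (0 : ℝ) T, 0 < ρ t)
    (hρ' : ∀ t ∈ Ico (0 : ℝ) T, HasDerivWithinAt ρ (-(ρ t * d t)) (Ico 0 T) t)
    (hd' : ∀ t ∈ Ico (0 : ℝ) T,
      HasDerivWithinAt d (-(d t) ^ 2 - ν * d t + k * (ρ t - c)) (Ico 0 T) t) :
    ContDiffOn ℝ 1 (fun t => -(d t / ρ t)) (Ico 0 T) ∧
    ContDiffOn ℝ 1 (fun t => 1 / ρ t) (Ico 0 T) ∧
    (∀ t ∈ Ico (0 : ℝ) T,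
      HasDerivWithinAt (fun t => -(d t / ρ t))
        (-ν * (-(d t / ρ t)) - k * (1 - c * (1 / ρ t))) (Ico 0 T) t) ∧
    (∀ t ∈ Ico (0 : ℝ) T,
      HasDerivWithinAt (fun t => 1 / ρ t) (-(-(d t / ρ t))) (Ico 0 T) t) ∧
    (∀ t ∈ Ico (0 : ℝ) T,
      derivWithin (derivWithin (fun t => 1 / ρ t) (Ico 0 T)) (Ico 0 T) t +
        ν * derivWithin (fun t => 1 / ρ t) (Ico 0 T) t + k * c * (1 / ρ t) = k) ∧
    derivWithin (fun t => 1 / ρ t) (Ico 0 T) 0 = d 0 / ρ 0 := by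
  have hne : ∀ t ∈ Ico (0 : ℝ) T, ρ t ≠ 0 := fun t ht => (hρpos t ht).ne'
  have hr : ∀ t ∈ Ico (0 : ℝ) T,
      HasDerivWithinAt (fun t => -(d t / ρ t))
        (-ν * (-(d t / ρ t)) - k * (1 - c * (1 / ρ t))) (Ico 0 T) t := by
    intro t ht
    have h0 := hne t ht
    refine ((hd' t ht).fun_div (hρ' t ht) h0).fun_neg.congr_deriv ?_
    field_simp
    ring
  have hs : ∀ t ∈ Ico (0 : ℝ) T,
      HasDerivWithinAt (fun t => 1 / ρ t) (-(-(d t / ρ t))) (Ico 0 T) t := by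
    intro t ht
    have h0 := hne t ht
    refine ((hasDerivWithinAt_const t (Ico 0 T) (1 : ℝ)).fun_div (hρ' t ht) h0).congr_deriv ?_
    field_simp
    ring
  have hs_deriv : ∀ t ∈ Ico (0 : ℝ) T,
      derivWithin (fun t => 1 / ρ t) (Ico 0 T) t = -(-(d t / ρ t)) := fun t ht =>
    (hs t ht).derivWithin (uniqueDiffOn_Ico 0 T t ht)
  refine ⟨(hdC1.div hρC1 hne).neg, contDiffOn_const.div hρC1 hne, hr, hs, fun t ht => ?_, ?_⟩
  · have hss := ((hr t ht).fun_neg.congr hs_deriv (hs_deriv t ht)).derivWithin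
      (uniqueDiffOn_Ico 0 T t ht)
    rw [hss, hs_deriv t ht]
    ring
  · rw [hs_deriv 0 ⟨le_rfl, hT⟩, neg_neg]
end

section
/- Let γ > 0, θ > 0, c₀, c₁, c₂ ∈ ℝ with (c₁, c₂) ≠ (0, 0), and define f(t) = c₀ + e^{−γ t}(c₁ cos(θ t) + c₂ sin(θ t)). If τ is a local minimum point of f, then f(τ) = c₀ − e^{−γ τ} θ √(c₁² + c₂²)/√(θ² + γ²). -/
open Set Filter

/-- The second-order necessary condition for a local minimum. -/
theorem IsLocalMin.deriv_deriv_nonneg {f : ℝ → ℝ} {a : ℝ} (h : IsLocalMin f a)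
    (hf : ContinuousAt f a) : 0 ≤ deriv (deriv f) a := by
  by_contra! hneg
  have hmax : IsLocalMax f a := isLocalMax_of_deriv_deriv_neg hneg h.deriv_eq_zero hf
  have hconst : f =ᶠ[nhds a] fun _ => f a := by
    filter_upwards [h, hmax] with x hx hx' using le_antisymm hx' hx
  have hzero : deriv (deriv f) a = 0 := by
    rw [hconst.deriv.deriv_eq]
    simp
  exact hneg.ne hzero

theorem hasDerivAt_damped_oscillation (γ θ c₀ c₁ c₂ t : ℝ) :
    HasDerivAt
      (fun t => c₀ + Real.exp (-(γ * t)) * (c₁ * Real.cos (θ * t) + c₂ * Real.sin (θ * t)))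
      (Real.exp (-(γ * t)) * ((θ * c₂ - γ * c₁) * Real.cos (θ * t) +
        (-(θ * c₁) - γ * c₂) * Real.sin (θ * t))) t := by
  have hlin (k : ℝ) : HasDerivAt (fun t => k * t) k t := by
    simpa using (hasDerivAt_id t).const_mul k
  have h := (((hlin γ).neg.exp).mul
    (((hlin θ).cos.const_mul c₁).add ((hlin θ).sin.const_mul c₂))).const_add c₀
  refine h.congr_deriv ?_
  simp only [Pi.add_apply, Pi.neg_apply]
  ring

/-- **Value of a damped oscillation at a local minimum** (Section 3.2).
For `γ, θ > 0` and `(c₁, c₂) ≠ (0,0)`, if `τ` is a local minimum point of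
`f(t) = c₀ + e^{-γt}(c₁cos(θt) + c₂sin(θt))`, then
`f(τ) = c₀ - e^{-γτ}θ√(c₁² + c₂²)/√(θ² + γ²)`. -/
theorem damped_oscillation_local_min (γ θ c₀ c₁ c₂ : ℝ)
    (hγ : 0 < γ) (hθ : 0 < θ) (hc : (c₁, c₂) ≠ (0, 0)) (τ : ℝ)
    (hτ : IsLocalMin
      (fun t => c₀ + Real.exp (-(γ * t)) * (c₁ * Real.cos (θ * t) + c₂ * Real.sin (θ * t))) τ) :
    c₀ + Real.exp (-(γ * τ)) * (c₁ * Real.cos (θ * τ) + c₂ * Real.sin (θ * τ)) =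
      c₀ - Real.exp (-(γ * τ)) * θ * Real.sqrt (c₁ ^ 2 + c₂ ^ 2) /
        Real.sqrt (θ ^ 2 + γ ^ 2) := by
  have hE := Real.exp_pos (-(γ * τ))
  have hfirst := hτ.hasDerivAt_eq_zero (hasDerivAt_damped_oscillation γ θ c₀ c₁ c₂ τ)
  have hsecond :=
    hτ.deriv_deriv_nonneg (hasDerivAt_damped_oscillation γ θ c₀ c₁ c₂ τ).continuousAt
  have hderiv := funext fun t => (hasDerivAt_damped_oscillation γ θ c₀ c₁ c₂ t).deriv
  have hderiv₂ := (hasDerivAt_damped_oscillation γ θ 0 (θ * c₂ - γ * c₁)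
    (-(θ * c₁) - γ * c₂) τ).deriv
  simp only [zero_add] at hderiv₂
  rw [hderiv, hderiv₂] at hsecond
  replace hfirst := (mul_eq_zero.mp hfirst).resolve_left hE.ne'
  replace hsecond := nonneg_of_mul_nonneg_right hsecond hE
  have hD : 0 < θ ^ 2 + γ ^ 2 := by positivity
  have hcs := Real.sin_sq_add_cos_sq (θ * τ)
  set C := Real.cos (θ * τ)
  set S := Real.sin (θ * τ)
  have hA : c₁ * C + c₂ * S ≤ 0 := by
    have : 0 ≤ (θ ^ 2 + γ ^ 2) * -(c₁ * C + c₂ * S) := by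
      linear_combination hsecond - 2 * γ * hfirst
    linarith [nonneg_of_mul_nonneg_right this hD]
  have hsq : (-(c₁ * C + c₂ * S)) ^ 2 * (θ ^ 2 + γ ^ 2) = θ ^ 2 * (c₁ ^ 2 + c₂ ^ 2) := by
    linear_combination θ ^ 2 * (c₁ ^ 2 + c₂ ^ 2) * hcs -
      (θ * (c₂ * C - c₁ * S) + γ * (c₁ * C + c₂ * S)) * hfirst
  have hval : -(c₁ * C + c₂ * S) * Real.sqrt (θ ^ 2 + γ ^ 2) =
      θ * Real.sqrt (c₁ ^ 2 + c₂ ^ 2) := by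
    have h := congrArg Real.sqrt hsq
    rwa [Real.sqrt_mul (sq_nonneg _), Real.sqrt_mul (sq_nonneg _),
      Real.sqrt_sq (neg_nonneg.mpr hA), Real.sqrt_sq hθ.le] at h
  rw [mul_assoc, ← hval, ← mul_assoc, mul_div_cancel_right₀ _ (Real.sqrt_pos.mpr hD).ne']
  ring
end

section
/- Let k > 0, c > 0 and ν > 2√(kc), and let Q_a : [0,∞) → [0,∞) be the continuous function with Q_a(0) = 0, Q_a(s) > 0 for s > 0, differentiable on (0,∞) and satisfying dQ_a/ds = ν + (k/Q_a)(1 − cs). Then Q_a is strictly increasing on [0,∞), lim_{s → 0⁺} Q_a(s)/s = +∞, and lim_{s → ∞} Q_a(s)/s = (ν + √(ν² − 4kc))/2. -/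
open Set Filter

/-- If `z' = a z / q` on `(0,∞)` with `a, q > 0` and `z 0 > 0`, then `z ≥ z 0` on `[0,∞)`. -/
lemma le_of_hasDerivAt_mul_div {z q : ℝ → ℝ} {a : ℝ} (ha : 0 < a)
    (hz : ContinuousOn z (Ici 0)) (hz0 : 0 < z 0) (hq : ∀ s, 0 < s → 0 < q s)
    (hd : ∀ s, 0 < s → HasDerivAt z (a * z s / q s) s) {s : ℝ} (hs : 0 ≤ s) :
    z 0 ≤ z s := by
  have hsq : MonotoneOn (fun s => z s ^ 2) (Ici 0) := by
    refine monotoneOn_of_hasDerivWithinAt_nonneg (convex_Ici 0) (hz.pow 2)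
      (f' := fun s => 2 * a * z s ^ 2 / q s) ?_ ?_
    · intro x hx
      rw [interior_Ici] at hx
      refine (((hd x hx).pow 2).congr_deriv ?_).hasDerivWithinAt
      push_cast
      ring
    · intro x hx
      rw [interior_Ici] at hx
      have := hq x hx
      positivity
  have hle : z 0 ^ 2 ≤ z s ^ 2 := hsq self_mem_Ici hs hs
  have hpos : 0 < z s := by
    by_contra! h
    obtain ⟨t, ht, h0⟩ := intermediate_value_Icc' hs
      (hz.mono Icc_subset_Ici_self) (show (0 : ℝ) ∈ Icc (z s) (z 0) from ⟨h, hz0.le⟩)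
    have : z 0 ^ 2 ≤ z t ^ 2 := hsq self_mem_Ici ht.1 ht.1
    rw [h0] at this
    nlinarith
  exact (sq_le_sq₀ hz0.le hpos.le).1 hle

/-- If `z ≥ 0` and `z' = a z / q` on `(0,∞)` where `q s ≥ b s` and `0 < a < b`, then
`z s / s → 0` at infinity. -/
lemma tendsto_div_of_hasDerivAt_mul_div {z q : ℝ → ℝ} {a b : ℝ} (ha : 0 < a) (hab : a < b)
    (hz : ∀ s, 0 < s → 0 ≤ z s) (hq : ∀ s, 0 < s → b * s ≤ q s)
    (hd : ∀ s, 0 < s → HasDerivAt z (a * z s / q s) s) :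
    Tendsto (fun s => z s / s) atTop (nhds 0) := by
  have hb : 0 < b := ha.trans hab
  have hderiv : ∀ s : ℝ, 0 < s → HasDerivAt (fun s => z s * s ^ (-(a / b)))
      (a * z s / q s * s ^ (-(a / b)) + z s * (-(a / b) * s ^ (-(a / b) - 1))) s :=
    fun s hs => (hd s hs).mul (Real.hasDerivAt_rpow_const (Or.inl hs.ne'))
  have hanti : AntitoneOn (fun s => z s * s ^ (-(a / b))) (Ioi 0) := by
    refine antitoneOn_of_hasDerivWithinAt_nonpos (convex_Ioi 0)
      (fun s hs => (hderiv s hs).continuousAt.continuousWithinAt)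
      (fun s hs => (hderiv s (interior_subset hs)).hasDerivWithinAt) ?_
    intro s hs
    have hs : 0 < s := interior_subset hs
    have hbs : 0 < b * s := mul_pos hb hs
    have h1 : a * z s / q s ≤ a * z s / (b * s) :=
      div_le_div_of_nonneg_left (mul_nonneg ha.le (hz s hs)) hbs (hq s hs)
    have h2 : z s * (-(a / b) * s ^ (-(a / b) - 1)) =
        -(a * z s / (b * s)) * s ^ (-(a / b)) := by
      rw [Real.rpow_sub_one hs.ne']
      field_simp
    rw [h2, ← add_mul]
    exact mul_nonpos_of_nonpos_of_nonneg (by linarith) (Real.rpow_nonneg hs.le _)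
  have hlim : Tendsto (fun s : ℝ => z 1 * s ^ (-(1 - a / b))) atTop (nhds 0) := by
    simpa using (tendsto_rpow_neg_atTop (sub_pos.2 ((div_lt_one hb).2 hab))).const_mul (z 1)
  refine squeeze_zero' ?_ ?_ hlim
  · filter_upwards [eventually_gt_atTop 0] with s hs
    exact div_nonneg (hz s hs) hs.le
  · filter_upwards [eventually_ge_atTop 1] with s hs
    have hs0 : 0 < s := by linarith
    have h : z s * s ^ (-(a / b)) ≤ z 1 := by
      simpa using hanti (mem_Ioi.2 one_pos) (mem_Ioi.2 hs0) hs
    have he : z s / s = z s * s ^ (-(a / b)) * s ^ (-(1 - a / b)) := by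
      rw [mul_assoc, ← Real.rpow_add hs0, show -(a / b) + -(1 - a / b) = -1 by ring,
        Real.rpow_neg_one, div_eq_mul_inv]
    rw [he]
    exact mul_le_mul_of_nonneg_right h (Real.rpow_nonneg hs0.le _)

/-- **Properties of the threshold curve `Q_a`, strong damping** (Section 4.1).
For `k, c > 0` and `ν > 2√(kc)`, the continuous function `Q_a : [0,∞) → [0,∞)`
with `Q_a(0) = 0`, `Q_a > 0` on `(0,∞)`, solving `dQ_a/ds = ν + (k/Q_a)(1 - cs)`,
is strictly increasing on `[0,∞)`, satisfies `Q_a(s)/s → +∞` as `s → 0⁺`, and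
`Q_a(s)/s → (ν + √(ν² - 4kc))/2` as `s → ∞`. -/
theorem Qa_threshold_curve_properties (k c ν : ℝ)
    (hk : 0 < k) (hc : 0 < c) (hν : 2 * Real.sqrt (k * c) < ν)
    (Qa : ℝ → ℝ) (hQcont : ContinuousOn Qa (Ici 0)) (hQ0 : Qa 0 = 0)
    (hQpos : ∀ s : ℝ, 0 < s → 0 < Qa s)
    (hQode : ∀ s : ℝ, 0 < s → HasDerivAt Qa (ν + k / Qa s * (1 - c * s)) s) :
    StrictMonoOn Qa (Ici 0) ∧
    Tendsto (fun s => Qa s / s) (nhdsWithin 0 (Ioi 0)) atTop ∧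
    Tendsto (fun s => Qa s / s) atTop
      (nhds ((ν + Real.sqrt (ν ^ 2 - 4 * k * c)) / 2)) := by
  have hkc : 0 < k * c := mul_pos hk hc
  have hν0 : 0 < ν := lt_of_le_of_lt (by positivity) hν
  have hdisc : 0 < ν ^ 2 - 4 * k * c := by
    nlinarith [Real.sq_sqrt hkc.le, Real.sqrt_nonneg (k * c)]
  obtain ⟨R, hR⟩ : ∃ R, R = Real.sqrt (ν ^ 2 - 4 * k * c) := ⟨_, rfl⟩
  have hR0 : 0 < R := hR ▸ Real.sqrt_pos.2 hdisc
  have hR2 : R ^ 2 = ν ^ 2 - 4 * k * c := hR ▸ Real.sq_sqrt hdisc.le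
  have hRν : R < ν := by nlinarith
  rw [← hR]
  obtain ⟨L, hL⟩ : ∃ L, L = (ν + R) / 2 := ⟨_, rfl⟩
  obtain ⟨l, hl⟩ : ∃ l, l = (ν - R) / 2 := ⟨_, rfl⟩
  rw [← hL]
  have hl0 : 0 < l := by linarith
  have hlL : l < L := by linarith
  have hL0 : 0 < L := hl0.trans hlL
  have hsum : ν = L + l := by linarith
  have hprod : k * c = L * l := by rw [hL, hl]; linarith
  -- `z` measures the deviation from the line of slope `L` and satisfies `z' = l z / Qa`.
  let z : ℝ → ℝ := fun s => l * (Qa s - L * s) + k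
  have hode : ∀ s, 0 < s → ν + k / Qa s * (1 - c * s) = L + z s / Qa s := by
    intro s hs
    have hQ := (hQpos s hs).ne'
    simp only [z]
    rw [hsum]
    field_simp
    linear_combination (-s) * hprod
  have hzc : ContinuousOn z (Ici 0) := by
    simp only [z]
    fun_prop
  have hz0 : z 0 = k := by simp [z, hQ0]
  have hzd : ∀ s, 0 < s → HasDerivAt z (l * z s / Qa s) s := by
    intro s hs
    refine ((((hQode s hs).sub ((hasDerivAt_id s).const_mul L)).const_mul l).add_const
      k).congr_deriv ?_
    rw [hode s hs]
    ring
  have hzk : ∀ s, 0 < s → k ≤ z s := fun s hs =>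
    hz0 ▸ le_of_hasDerivAt_mul_div hl0 hzc (hz0 ▸ hk) hQpos hzd hs.le
  have hQL : ∀ s, 0 < s → L * s ≤ Qa s := by
    intro s hs
    have h : 0 ≤ l * (Qa s - L * s) := by linarith [hzk s hs, show z s = _ from rfl]
    linarith [nonneg_of_mul_nonneg_right h hl0]
  refine ⟨?_, ?_, ?_⟩
  · refine strictMonoOn_of_hasDerivWithinAt_pos (convex_Ici 0) hQcont
      (f' := fun s => ν + k / Qa s * (1 - c * s)) ?_ ?_
    · intro s hs
      rw [interior_Ici] at hs
      exact (hQode s hs).hasDerivWithinAt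
    · intro s hs
      rw [interior_Ici] at hs
      rw [hode s hs]
      have := hQpos s hs
      have := hk.trans_le (hzk s hs)
      positivity
  · have hmono : MonotoneOn (fun s => Qa s ^ 2 - 2 * k * s) (Ici 0) := by
      refine monotoneOn_of_hasDerivWithinAt_nonneg (convex_Ici 0) (by fun_prop)
        (f' := fun s => 2 * (L * Qa s + (z s - k))) ?_ ?_
      · intro s hs
        rw [interior_Ici] at hs
        refine ((((hQode s hs).pow 2).sub
          ((hasDerivAt_id s).const_mul (2 * k))).congr_deriv ?_).hasDerivWithinAt
        rw [hode s hs]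
        have hQ := (hQpos s hs).ne'
        field_simp
        push_cast
        ring
      · intro s hs
        rw [interior_Ici] at hs
        have := mul_pos hL0 (hQpos s hs)
        linarith [hzk s hs]
    have hlim : Tendsto (fun s : ℝ => Real.sqrt (2 * k * s⁻¹)) (nhdsWithin 0 (Ioi 0)) atTop :=
      Real.tendsto_sqrt_atTop.comp
        (tendsto_inv_nhdsGT_zero.const_mul_atTop (by positivity))
    refine tendsto_atTop_mono' _ ?_ hlim
    filter_upwards [self_mem_nhdsWithin] with s hs
    have hs : 0 < s := hs
    have h : (fun s => Qa s ^ 2 - 2 * k * s) 0 ≤ (fun s => Qa s ^ 2 - 2 * k * s) s :=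
      hmono self_mem_Ici hs.le hs.le
    simp only [hQ0] at h
    refine Real.sqrt_le_iff.2 ⟨(div_pos (hQpos s hs) hs).le, ?_⟩
    rw [div_pow, le_div_iff₀ (by positivity)]
    field_simp
    linarith
  · have hlim := tendsto_div_of_hasDerivAt_mul_div hl0 hlL
      (fun s hs => hk.le.trans (hzk s hs)) hQL hzd
    have h : Tendsto (fun s => L + (z s / s - k * s⁻¹) / l) atTop
        (nhds (L + (0 - k * 0) / l)) :=
      ((hlim.sub (tendsto_inv_atTop_zero.const_mul k)).div_const l).const_add L
    rw [mul_zero, sub_zero, zero_div, add_zero] at h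
    refine h.congr' ?_
    filter_upwards [eventually_gt_atTop 0] with s hs
    simp only [z]
    field_simp
    ring
end
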